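/- For two POVMs A = {A_a}_{a∈Ω} and A' = {A'_a}_{a∈Ω} over a common finite outcome set Ω, the supremum over states of the total variation distance between outcome distributions equals the maximum over subsets: sup_ω (1/2)Σ_a |ω(A_a) - ω(A'_a)| = max_{Δ⊆Ω} ‖Σ_{a∈Δ} A_a - Σ_{a∈Δ} A'_a‖. -/

import Mathlib

open scoped ComplexOrder

/-- A state on B(H): a unital positive linear functional. -/
def IsState {H : Type*} [NormedAddCommGroup H] [InnerProductSpace ℂ H] [CompleteSpace H]
    (ω : (H →L[ℂ] H) →ₗ[ℂ] ℂ) : Prop :=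
  ω 1 = 1 ∧ ∀ X : H →L[ℂ] H, X.IsPositive → 0 ≤ ω X

/-- The vector state `X ↦ ⟪x, X x⟫`, as a linear functional. -/
noncomputable def vectorFunctional {H : Type*} [NormedAddCommGroup H] [InnerProductSpace ℂ H]
    (x : H) : (H →L[ℂ] H) →ₗ[ℂ] ℂ where
  toFun X := inner ℂ x (X x)
  map_add' X Y := by simp
  map_smul' c X := by simp

section State

variable {H : Type*} [NormedAddCommGroup H] [InnerProductSpace ℂ H] [CompleteSpace H]

lemma isState_vectorFunctional {x : H} (hx : ‖x‖ = 1) : IsState (vectorFunctional x) := by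
  refine ⟨?_, fun X hX => hX.inner_nonneg_right x⟩
  change inner ℂ x x = 1
  rw [inner_self_eq_norm_sq_to_K, hx]
  simp

lemma IsState.im_eq_zero {ω : (H →L[ℂ] H) →ₗ[ℂ] ℂ} (hω : IsState ω) {X : H →L[ℂ] H}
    (hX : X.IsPositive) : (ω X).im = 0 :=
  (Complex.nonneg_iff.mp (hω.2 X hX)).2.symm

lemma IsState.re_le_norm {ω : (H →L[ℂ] H) →ₗ[ℂ] ℂ} (hω : IsState ω) {X : H →L[ℂ] H}
    (hX : IsSelfAdjoint X) : (ω X).re ≤ ‖X‖ := by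
  have h := (Complex.nonneg_iff.mp
    (hω.2 _ ((ContinuousLinearMap.le_def _ _).mp hX.le_algebraMap_norm_self))).1
  have h1 : algebraMap ℝ (H →L[ℂ] H) ‖X‖ = ((‖X‖ : ℝ) : ℂ) • (1 : H →L[ℂ] H) := by
    rw [Algebra.algebraMap_eq_smul_one, Complex.coe_smul]
  rw [h1, map_sub, map_smul, hω.1] at h
  simpa using h

/-- The norm of a self-adjoint operator is bounded by any bound on its expectations in
unit vectors. -/
lemma IsSelfAdjoint.norm_le_of_abs_re_vectorFunctional_le {T : H →L[ℂ] H} (hT : IsSelfAdjoint T)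
    {C : ℝ} (hC : 0 ≤ C) (h : ∀ x : H, ‖x‖ = 1 → |(vectorFunctional x T).re| ≤ C) : ‖T‖ ≤ C := by
  rw [T.norm_eq_iSup_rayleighQuotient hT.isSymmetric]
  refine ciSup_le fun x => ?_
  by_cases hx : x = 0
  · simpa [hx] using hC
  have hx' : ((‖x‖⁻¹ : ℝ) : ℂ) ≠ 0 := by simpa using hx
  have hn : ‖((‖x‖⁻¹ : ℝ) : ℂ) • x‖ = 1 := by
    simp [norm_smul, hx]
  rw [← T.rayleigh_smul x hx', ContinuousLinearMap.rayleighQuotient, hn,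
    ContinuousLinearMap.reApplyInnerSelf_apply, one_pow, div_one, inner_re_symm]
  exact h _ hn

end State

section ZeroSum

variable {Ω : Type*} [Fintype Ω]

lemma abs_sum_le_half_sum_abs_of_sum_eq_zero {x : Ω → ℝ} (hx : ∑ a, x a = 0) (Δ : Finset Ω) :
    |∑ a ∈ Δ, x a| ≤ (1 / 2) * ∑ a, |x a| := by
  classical
  have h1 := Finset.sum_add_sum_compl Δ x
  have h2 := Finset.sum_add_sum_compl Δ fun a => |x a|
  have h3 := Finset.abs_sum_le_sum_abs x Δ
  have h4 := Finset.abs_sum_le_sum_abs x Δᶜ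
  have h5 : ∑ a ∈ Δᶜ, x a = -∑ a ∈ Δ, x a := by linarith
  rw [h5, abs_neg] at h4
  linarith

lemma exists_half_sum_abs_eq_sum_of_sum_eq_zero {x : Ω → ℝ} (hx : ∑ a, x a = 0) :
    ∃ Δ : Finset Ω, (1 / 2) * ∑ a, |x a| = ∑ a ∈ Δ, x a := by
  classical
  refine ⟨Finset.univ.filter fun a => 0 ≤ x a, ?_⟩
  have h : ∑ a, |x a| = ∑ a, (2 * (if 0 ≤ x a then x a else 0) - x a) := by
    refine Finset.sum_congr rfl fun a _ => ?_
    split_ifs with ha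
    · rw [abs_of_nonneg ha]; ring
    · rw [abs_of_neg (not_le.mp ha)]; ring
  rw [h, Finset.sum_sub_distrib, hx, ← Finset.mul_sum, Finset.sum_filter]
  ring

end ZeroSum

theorem sup_state_l1_dist_eq_max_subset_norm {H : Type*} [NormedAddCommGroup H]
    [InnerProductSpace ℂ H] [CompleteSpace H]
    {Ω : Type*} [Fintype Ω]
    (A A' : Ω → (H →L[ℂ] H))
    (hApos : ∀ a, (A a).IsPositive) (hAsum : ∑ a, A a = 1)
    (hA'pos : ∀ a, (A' a).IsPositive) (hA'sum : ∑ a, A' a = 1) :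
    sSup {d : ℝ | ∃ ω : (H →L[ℂ] H) →ₗ[ℂ] ℂ, IsState ω ∧
        d = (1 / 2) * ∑ a, ‖ω (A a) - ω (A' a)‖} =
      ⨆ Δ : Finset Ω, ‖∑ a ∈ Δ, (A a - A' a)‖ := by
  have hsa : ∀ Δ : Finset Ω, IsSelfAdjoint (∑ a ∈ Δ, (A a - A' a)) := fun Δ =>
    isSelfAdjoint_sum Δ fun a _ => (hApos a).isSelfAdjoint.sub (hA'pos a).isSelfAdjoint
  have hdist : ∀ ω : (H →L[ℂ] H) →ₗ[ℂ] ℂ, IsState ω →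
      ∑ a, ‖ω (A a) - ω (A' a)‖ = ∑ a, |(ω (A a - A' a)).re| := by
    intro ω hω
    refine Finset.sum_congr rfl fun a _ => ?_
    rw [← map_sub, Complex.abs_re_eq_norm.mpr]
    simp [hω.im_eq_zero (hApos a), hω.im_eq_zero (hA'pos a)]
  have hre : ∀ (ω : (H →L[ℂ] H) →ₗ[ℂ] ℂ) (Δ : Finset Ω),
      ∑ a ∈ Δ, (ω (A a - A' a)).re = (ω (∑ a ∈ Δ, (A a - A' a))).re := by
    intro ω Δ
    rw [map_sum, Complex.re_sum]
  have hzero : ∀ ω : (H →L[ℂ] H) →ₗ[ℂ] ℂ, ∑ a, (ω (A a - A' a)).re = 0 := by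
    intro ω
    rw [hre, Finset.sum_sub_distrib, hAsum, hA'sum]
    simp
  set S := {d : ℝ | ∃ ω : (H →L[ℂ] H) →ₗ[ℂ] ℂ, IsState ω ∧
    d = (1 / 2) * ∑ a, ‖ω (A a) - ω (A' a)‖}
  have hle : ∀ d ∈ S, d ≤ ⨆ Δ : Finset Ω, ‖∑ a ∈ Δ, (A a - A' a)‖ := by
    rintro d ⟨ω, hω, rfl⟩
    obtain ⟨Δ, hΔ⟩ := exists_half_sum_abs_eq_sum_of_sum_eq_zero (hzero ω)
    rw [hdist ω hω, hΔ, hre]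
    exact (hω.re_le_norm (hsa Δ)).trans
      (le_ciSup (f := fun Δ : Finset Ω => ‖∑ a ∈ Δ, (A a - A' a)‖)
        (Set.finite_range _).bddAbove Δ)
  have hS : 0 ≤ sSup S := by
    refine Real.sSup_nonneg ?_
    rintro d ⟨ω, -, rfl⟩
    positivity
  refine le_antisymm (Real.sSup_le hle (Real.iSup_nonneg fun Δ => norm_nonneg _))
    (ciSup_le fun Δ => (hsa Δ).norm_le_of_abs_re_vectorFunctional_le hS fun x hx => ?_)
  have hω := isState_vectorFunctional hx
  rw [← hre]
  refine (abs_sum_le_half_sum_abs_of_sum_eq_zero (hzero _) Δ).trans ?_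
  rw [← hdist _ hω]
  exact le_csSup ⟨_, hle⟩ ⟨_, hω, rfl⟩
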